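/- The Gerstenhaber bracket of two cocycles is a cocycle: if $f\in C^n$ and $g\in C^m$ satisfy $\delta_n(f)=0$ and $\delta_m(g)=0$, then $\delta_{n+m-1}([f,g])=0$; hence the bracket descends to $H^*_{S^2}(A,A)$. -/

import Mathlib

/-- An `S²`-cochain of degree `n` is (encoded as) a function on arrays `(ℕ → ℕ → A)` that only
depends on the triangular part of entries `(p, q)` with `1 ≤ p < q ≤ n`. -/
def IsCochain {A : Type*} (n : ℕ) (f : (ℕ → ℕ → A) → A) : Prop :=
  ∀ a b : ℕ → ℕ → A, (∀ p q : ℕ, 1 ≤ p → p < q → q ≤ n → a p q = b p q) → f a = f b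

/-- The operadic composition `f ∘ᵢ g` of an `S²`-cochain `f` of degree `n` with a cochain `g` of
degree `m` at position `1 ≤ i ≤ n`, a cochain of degree `n + m - 1`:
`(f ∘ᵢ g)(a) = f(b) · g((a_{p+i-1,q+i-1})_{1 ≤ p < q ≤ m})`, where `b` collapses the rows and
columns `i, …, i+m-1` of `a` by the operations `H` (products along rows) and `V` (products along
columns). -/
def circAt {A : Type*} [CommRing A] (f g : (ℕ → ℕ → A) → A) (m i : ℕ) :
    (ℕ → ℕ → A) → A := fun a =>
  f (fun p q =>
      if q < i then a p q
      else if p < i ∧ q = i then ∏ t ∈ Finset.Icc i (i + m - 1), a p t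
      else if p < i ∧ i < q then a p (q + m - 1)
      else if p = i ∧ i < q then ∏ t ∈ Finset.Icc i (i + m - 1), a t (q + m - 1)
      else a (p + m - 1) (q + m - 1)) *
    g (fun p q => a (p + i - 1) (q + i - 1))

/-- The (total) composition `f ∘ g = ∑_{i=1}^{n} (-1)^{(i-1)(m-1)} f ∘ᵢ g` of `S²`-cochains of
degrees `n` and `m`, a cochain of degree `n + m - 1`. -/
def circS2 {A : Type*} [CommRing A] (n m : ℕ) (f g : (ℕ → ℕ → A) → A) :
    (ℕ → ℕ → A) → A := fun a =>
  ∑ i ∈ Finset.Icc 1 n, (-1 : A) ^ ((i - 1) * (m - 1)) * circAt f g m i a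

/-- The Gerstenhaber bracket `[f, g] = f ∘ g - (-1)^{(n-1)(m-1)} g ∘ f` of `S²`-cochains of
degrees `n` and `m`, a cochain of degree `n + m - 1`. -/
def brackS2 {A : Type*} [CommRing A] (n m : ℕ) (f g : (ℕ → ℕ → A) → A) :
    (ℕ → ℕ → A) → A := fun a =>
  circS2 n m f g a - (-1 : A) ^ ((n - 1) * (m - 1)) * circS2 m n g f a

/-- The higher order Hochschild differential over `S²`: for a cochain `f` of degree `n`,
`δₙ(f)` is the cochain of degree `n + 1` given by the formula (4) of the paper. -/
def deltaS2 {A : Type*} [CommRing A] (n : ℕ) (f : (ℕ → ℕ → A) → A) :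
    (ℕ → ℕ → A) → A := fun a =>
  (∏ j ∈ Finset.Icc 2 (n + 1), a 1 j) * f (fun p q => a (p + 1) (q + 1)) +
    (∑ i ∈ Finset.Icc 1 n, (-1 : A) ^ i * (a i (i + 1) *
      f (fun p q =>
        if q < i then a p q
        else if p < i ∧ q = i then a p i * a p (i + 1)
        else if p < i ∧ i < q then a p (q + 1)
        else if p = i ∧ i < q then a i (q + 1) * a (i + 1) (q + 1)
        else a (p + 1) (q + 1)))) +
    (-1 : A) ^ (n + 1) * (∏ j ∈ Finset.Icc 1 n, a j (n + 1)) * f a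

open Finset in
theorem prod_tele {A : Type*} [CommRing A] (σ : ℕ → ℕ) (hσ : Monotone σ) (F : ℕ → A) (x y : ℕ)
    (h : x ≤ y) : ∏ u ∈ Ico x y, ∏ s ∈ Ico (σ u) (σ (u + 1)), F s = ∏ s ∈ Ico (σ x) (σ y), F s := by
  induction y, h using Nat.le_induction with
  | base => simp
  | succ y hy ih =>
    rw [Finset.prod_Ico_succ_top hy, ih, Finset.prod_Ico_consecutive _ (hσ hy) (hσ (Nat.le_succ y))]

/-- collapse along a monotone map -/
def coll {A : Type*} [CommRing A] (σ : ℕ → ℕ) (x : ℕ → ℕ → A) : ℕ → ℕ → A := fun p q =>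
  ∏ s ∈ Finset.Ico (σ p) (σ (p + 1)), ∏ t ∈ Finset.Ico (σ q) (σ (q + 1)), x s t

theorem coll_coll {A : Type*} [CommRing A] (σ τ : ℕ → ℕ) (hσ : Monotone σ) (hτ : Monotone τ)
    (x : ℕ → ℕ → A) : coll τ (coll σ x) = coll (fun p => σ (τ p)) x := by
  funext p q
  unfold coll
  rw [← prod_tele σ hσ _ _ _ (hτ (Nat.le_succ p))]
  refine Finset.prod_congr rfl fun u _ => ?_
  rw [Finset.prod_comm]
  refine Finset.prod_congr rfl fun s _ => ?_
  exact (prod_tele σ hσ _ _ _ (hτ (Nat.le_succ q)))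

theorem coch_coll {A : Type*} [CommRing A] {n : ℕ} {f : (ℕ → ℕ → A) → A} (hf : IsCochain (n + 1) f)
    (σ τ : ℕ → ℕ) (h : ∀ p, 1 ≤ p → p ≤ n + 2 → σ p = τ p) (x : ℕ → ℕ → A) :
    f (coll σ x) = f (coll τ x) := by
  apply hf
  intro p q h1 h2 h3
  unfold coll
  rw [h p h1 (by omega), h (p + 1) (by omega) (by omega), h q (by omega) (by omega),
    h (q + 1) (by omega) (by omega)]

def sg (i b : ℕ) : ℕ → ℕ := fun p => if p ≤ i + 1 then p else p + b
def sh (i : ℕ) : ℕ → ℕ := fun p => p + i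

theorem sg_mono (i b : ℕ) : Monotone (sg i b) := by
  intro p q h
  unfold sg
  split_ifs <;> omega

theorem sh_mono (i : ℕ) : Monotone (sh i) := by
  intro p q h
  unfold sh
  omega

/-- reindexed composition -/
def cc {A : Type*} [CommRing A] (a b : ℕ) (f g : (ℕ → ℕ → A) → A) : (ℕ → ℕ → A) → A := fun x =>
  ∑ i ∈ Finset.range (a + 1), (-1 : A) ^ (i * b) * (f (coll (sg i b) x) * g (coll (sh i) x))

theorem circAt_eq {A : Type*} [CommRing A] {a : ℕ} (b i : ℕ) {f g : (ℕ → ℕ → A) → A}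
    (hf : IsCochain (a + 1) f) (x : ℕ → ℕ → A) :
    circAt f g (b + 1) (i + 1) x = f (coll (sg i b) x) * g (coll (sh i) x) := by
  unfold circAt
  congr 1
  · apply hf
    intro p q h1 h2 h3
    have e : Finset.Icc (i + 1) (i + 1 + (b + 1) - 1) = Finset.Ico (i + 1) (i + 2 + b) := by
      ext t; simp only [Finset.mem_Icc, Finset.mem_Ico]; omega
    rw [e]
    have key : ∀ r, (r ≠ i + 1 → ∃ v, sg i b r = v ∧ sg i b (r + 1) = v + 1 ∧
        v = if r < i + 1 then r else r + b) ∧ 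
        (r = i + 1 → sg i b r = i + 1 ∧ sg i b (r + 1) = i + 2 + b) := by
      intro r
      unfold sg
      constructor
      · intro h
        refine ⟨_, rfl, ?_, ?_⟩ <;> split_ifs <;> omega
      · rintro rfl
        constructor <;> split_ifs <;> omega
    unfold coll
    by_cases hp : p = i + 1
    · obtain ⟨e1, e2⟩ := (key p).2 hp
      obtain ⟨v, e3, e4, e5⟩ := (key q).1 (by omega)
      rw [e1, e2, e3, e4]
      rw [if_neg (by omega)] at e5
      rw [if_neg (by omega), if_neg (by omega), if_neg (by omega), if_pos (by omega)]
      simp [e5]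
    · obtain ⟨u, e1, e2, e6⟩ := (key p).1 hp
      rw [e1, e2]
      by_cases hq : q = i + 1
      · obtain ⟨e3, e4⟩ := (key q).2 hq
        rw [e3, e4]
        rw [if_pos (by omega)] at e6
        rw [if_neg (by omega), if_pos (by omega)]
        simp [e6]
      · obtain ⟨v, e3, e4, e5⟩ := (key q).1 hq
        rw [e3, e4]
        simp only [Nat.Ico_succ_singleton, Finset.prod_singleton]
        subst e5 e6
        split_ifs <;> first | rfl | omega
  · congr 1
    funext p q
    have e1 : p + 1 + i = (p + i) + 1 := by omega
    have e2 : q + 1 + i = (q + i) + 1 := by omega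
    simp [coll, sh, e1, e2, ← add_assoc]

theorem sum_Icc_one {A : Type*} [CommRing A] (n : ℕ) (F : ℕ → A) :
    ∑ i ∈ Finset.Icc 1 n, F i = ∑ i ∈ Finset.range n, F (i + 1) := by
  rw [Finset.range_eq_Ico, Finset.sum_Ico_add']
  refine Finset.sum_congr ?_ fun _ _ => rfl
  ext t; simp only [Finset.mem_Icc, Finset.mem_Ico]; omega

theorem circS2_eq {A : Type*} [CommRing A] {a : ℕ} (b : ℕ) {f g : (ℕ → ℕ → A) → A}
    (hf : IsCochain (a + 1) f) : circS2 (a + 1) (b + 1) f g = cc a b f g := by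
  funext x
  unfold circS2 cc
  rw [sum_Icc_one]
  refine Finset.sum_congr rfl fun i _ => ?_
  rw [circAt_eq b i hf]
  simp

theorem cc_cochain {A : Type*} [CommRing A] {a b : ℕ} {f g : (ℕ → ℕ → A) → A}
    (hf : IsCochain (a + 1) f) (hg : IsCochain (b + 1) g) :
    IsCochain (a + b + 1) (cc a b f g) := by
  intro x y h
  unfold cc
  refine Finset.sum_congr rfl fun i hi => ?_
  rw [Finset.mem_range] at hi
  congr 2
  · apply hf
    intro p q h1 h2 h3
    unfold coll
    refine Finset.prod_congr rfl fun s hs => Finset.prod_congr rfl fun t ht => ?_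
    rw [Finset.mem_Ico] at hs ht
    unfold sg at hs ht
    apply h <;> split_ifs at hs ht <;> omega
  · apply hg
    intro p q h1 h2 h3
    unfold coll
    refine Finset.prod_congr rfl fun s hs => Finset.prod_congr rfl fun t ht => ?_
    rw [Finset.mem_Ico] at hs ht
    unfold sh at hs ht
    apply h <;> omega

/-- iterated composition term -/
def TT {A : Type*} [CommRing A] (b c : ℕ) (f g h : (ℕ → ℕ → A) → A) (x : ℕ → ℕ → A)
    (i j : ℕ) : A :=
  (-1 : A) ^ (j * c + i * b) * (f (coll (fun p => sg j c (sg i b p)) x) *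
    g (coll (fun p => sg j c (sh i p)) x) * h (coll (sh j) x))

theorem assoc_eq {A : Type*} [CommRing A] {a b c : ℕ} {f g h : (ℕ → ℕ → A) → A}
    (hf : IsCochain (a + 1) f) (hg : IsCochain (b + 1) g) (hh : IsCochain (c + 1) h)
    (x : ℕ → ℕ → A) :
    cc (a + b) c (cc a b f g) h x - cc a (b + c) f (cc b c g h) x =
      ∑ i ∈ Finset.range (a + 1), ∑ j ∈ Finset.range i, TT b c f g h x i j +
      ∑ i ∈ Finset.range (a + 1), ∑ j ∈ Finset.Ico (i + 1) (a + 1), TT b c f g h x i (j + b) := by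
  have e1 : cc (a + b) c (cc a b f g) h x =
      ∑ i ∈ Finset.range (a + 1), ∑ j ∈ Finset.range (a + b + 1), TT b c f g h x i j := by
    rw [Finset.sum_comm]
    unfold cc
    refine Finset.sum_congr rfl fun j _ => ?_
    rw [Finset.sum_mul, Finset.mul_sum]
    refine Finset.sum_congr rfl fun i _ => ?_
    rw [coll_coll _ _ (sg_mono _ _) (sg_mono _ _), coll_coll _ _ (sg_mono _ _) (sh_mono _)]
    unfold TT
    rw [pow_add]
    ring
  have e2 : cc a (b + c) f (cc b c g h) x =
      ∑ i ∈ Finset.range (a + 1), ∑ l ∈ Finset.range (b + 1), TT b c f g h x i (i + l) := by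
    unfold cc
    refine Finset.sum_congr rfl fun i _ => ?_
    rw [Finset.mul_sum, Finset.mul_sum]
    refine Finset.sum_congr rfl fun l hl => ?_
    rw [Finset.mem_range] at hl
    rw [coll_coll _ _ (sh_mono _) (sg_mono _ _), coll_coll _ _ (sh_mono _) (sh_mono _)]
    unfold TT
    rw [coch_coll hf (fun p => sg (i + l) c (sg i b p)) (sg i (b + c)),
      coch_coll hg (fun p => sg (i + l) c (sh i p)) (fun p => sh i (sg l c p)),
      coch_coll hh (sh (i + l)) (fun p => sh i (sh l p))]
    · rw [show (i + l) * c + i * b = i * (b + c) + l * c by ring, pow_add]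
      ring
    · intro p _ _
      unfold sh; omega
    · intro p _ _
      unfold sh sg; split_ifs <;> omega
    · intro p _ _
      unfold sg; split_ifs <;> omega
  rw [e1, e2, ← Finset.sum_sub_distrib, ← Finset.sum_add_distrib]
  refine Finset.sum_congr rfl fun i hi => ?_
  rw [Finset.mem_range] at hi
  have e3 : ∑ l ∈ Finset.range (b + 1), TT b c f g h x i (i + l) =
      ∑ j ∈ Finset.Ico i (i + 1 + b), TT b c f g h x i j := by
    rw [Finset.sum_Ico_eq_sum_range, show i + 1 + b - i = b + 1 by omega]
  rw [Finset.sum_Ico_add' (fun j => TT b c f g h x i j), e3, Finset.range_eq_Ico,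
    Finset.range_eq_Ico,
    ← Finset.sum_Ico_consecutive _ (Nat.zero_le i) (show i ≤ a + b + 1 by omega),
    ← Finset.sum_Ico_consecutive _ (show i ≤ i + 1 + b by omega)
      (show i + 1 + b ≤ a + b + 1 by omega), show a + 1 + b = a + b + 1 by omega]
  ring

theorem TT_swap {A : Type*} [CommRing A] {a b c : ℕ} {f g h : (ℕ → ℕ → A) → A}
    (hf : IsCochain (a + 1) f) (hg : IsCochain (b + 1) g) (hh : IsCochain (c + 1) h)
    (x : ℕ → ℕ → A) :
    ∑ i ∈ Finset.range (a + 1), ∑ j ∈ Finset.range i, TT b c f g h x i j = 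
      (-1) ^ (b * c) * ∑ i ∈ Finset.range (a + 1), ∑ j ∈ Finset.Ico (i + 1) (a + 1),
        TT c b f h g x i (j + c) := by
  rw [Finset.sum_comm' (t' := Finset.range (a + 1)) (s' := fun i => Finset.Ico (i + 1) (a + 1)),
    Finset.mul_sum]
  · refine Finset.sum_congr rfl fun j _ => ?_
    rw [Finset.mul_sum]
    refine Finset.sum_congr rfl fun i hi => ?_
    rw [Finset.mem_Ico] at hi
    unfold TT
    rw [coch_coll hf (fun p => sg j c (sg i b p)) (fun p => sg (i + c) b (sg j c p)),
      coch_coll hg (fun p => sg j c (sh i p)) (sh (i + c)),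
      coch_coll hh (fun p => sg (i + c) b (sh j p)) (sh j)]
    · rw [show (i + c) * b + j * c = b * c + (j * c + i * b) by ring, pow_add _ (b * c)]
      have hq : (-1 : A) ^ (b * c) * (-1) ^ (b * c) = 1 := by
        rw [← mul_pow]; simp
      linear_combination (-((-1 : A) ^ (j * c + i * b) *
        (f (coll (fun p => sg (i + c) b (sg j c p)) x) * g (coll (sh (i + c)) x) *
          h (coll (sh j) x)))) * hq
    · intro p _ _
      unfold sg sh; split_ifs <;> omega
    · intro p _ _
      unfold sg sh; split_ifs <;> omega
    · intro p _ _
      unfold sg; split_ifs <;> omega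
  · intro i j
    simp only [Finset.mem_range, Finset.mem_Ico]
    omega

theorem neg_pow_sq {A : Type*} [CommRing A] (k : ℕ) : (-1 : A) ^ k * (-1) ^ k = 1 := by
  rw [← mul_pow]; simp

theorem assoc_symm {A : Type*} [CommRing A] {a b c : ℕ} {f g h : (ℕ → ℕ → A) → A}
    (hf : IsCochain (a + 1) f) (hg : IsCochain (b + 1) g) (hh : IsCochain (c + 1) h)
    (x : ℕ → ℕ → A) :
    cc (a + b) c (cc a b f g) h x - cc a (b + c) f (cc b c g h) x = (-1) ^ (b * c) *
    (cc (a + c) b (cc a c f h) g x - cc a (c + b) f (cc c b h g) x) := by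
  rw [assoc_eq hf hg hh, assoc_eq hf hh hg, TT_swap hf hg hh, TT_swap hf hh hg, mul_comm c b,
    mul_add, ← mul_assoc, neg_pow_sq]
  ring

def mu {A : Type*} [CommRing A] : (ℕ → ℕ → A) → A := fun x => x 1 2

theorem mu_cochain {A : Type*} [CommRing A] : IsCochain (1 + 1) (mu (A := A)) := by
  intro x y h
  exact h 1 2 (by omega) (by omega) (by omega)

theorem delta_eq {A : Type*} [CommRing A] {a : ℕ} {f : (ℕ → ℕ → A) → A}
    (hf : IsCochain (a + 1) f) (x : ℕ → ℕ → A) :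
    deltaS2 (a + 1) f x = (-1) ^ a * cc 1 a mu f x - cc a 1 f mu x := by
  have e1 : cc a 1 f mu x = - ∑ i ∈ Finset.Icc 1 (a + 1), (-1 : A) ^ i * (x i (i + 1) *
      f (fun p q =>
        if q < i then x p q
        else if p < i ∧ q = i then x p i * x p (i + 1)
        else if p < i ∧ i < q then x p (q + 1)
        else if p = i ∧ i < q then x i (q + 1) * x (i + 1) (q + 1)
        else x (p + 1) (q + 1))) := by
    rw [← circS2_eq 1 hf]
    unfold circS2
    rw [← Finset.sum_neg_distrib]
    refine Finset.sum_congr rfl fun i hi => ?_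
    rw [Finset.mem_Icc] at hi
    have hI : Finset.Icc i (i + (1 + 1) - 1) = {i, i + 1} := by
      ext t; simp only [Finset.mem_Icc, Finset.mem_insert, Finset.mem_singleton]; omega
    have hP : ∀ F : ℕ → A, ∏ t ∈ ({i, i + 1} : Finset ℕ), F t = F i * F (i + 1) := fun F =>
      Finset.prod_pair (by omega)
    unfold circAt mu
    rw [hI]
    simp only [hP]
    obtain ⟨k, rfl⟩ : ∃ k, i = k + 1 := ⟨i - 1, by omega⟩
    simp only [show ∀ r, r + (1 + 1) - 1 = r + 1 from fun r => by omega,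
      show 1 + (k + 1) - 1 = k + 1 by omega, show 2 + (k + 1) - 1 = k + 1 + 1 by omega,
      show k + 1 - 1 = k by omega, show 1 + 1 - 1 = 1 by omega, mul_one, pow_succ (-1 : A) k]
    ring
  have e2 : cc 1 a mu f x = (∏ j ∈ Finset.Icc 1 (a + 1), x j (a + 2)) * f x +
      (-1) ^ a * ((∏ j ∈ Finset.Icc 2 (a + 2), x 1 j) * f (fun p q => x (p + 1) (q + 1))) := by
    unfold cc mu
    rw [Finset.sum_range_succ, Finset.sum_range_one]
    have hs : ∀ i, coll (sh i) x = fun p q => x (p + i) (q + i) := by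
      intro i
      funext p q
      have e1 : p + 1 + i = (p + i) + 1 := by omega
      have e2 : q + 1 + i = (q + i) + 1 := by omega
      simp [coll, sh, e1, e2]
    have i1 : Finset.Icc 1 (a + 1) = Finset.Ico 1 (2 + a) := by
      ext t; simp only [Finset.mem_Icc, Finset.mem_Ico]; omega
    have i2 : Finset.Icc 2 (a + 2) = Finset.Ico 2 (3 + a) := by
      ext t; simp only [Finset.mem_Icc, Finset.mem_Ico]; omega
    have c0 : coll (sg 0 a) x 1 2 = ∏ j ∈ Finset.Icc 1 (a + 1), x j (a + 2) := by
      rw [i1]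
      have : Finset.Ico (2 + a) (3 + a) = {a + 2} := by
        ext t; simp only [Finset.mem_singleton, Finset.mem_Ico]; omega
      simp [coll, sg, this]
    have c1 : coll (sg 1 a) x 1 2 = ∏ j ∈ Finset.Icc 2 (a + 2), x 1 j := by
      rw [i2]
      have : Finset.Ico 1 2 = {1} := by
        ext t; simp only [Finset.mem_singleton, Finset.mem_Ico]; omega
      simp [coll, sg, this]
    rw [hs, hs, c0, c1]
    simp
  rw [e1, e2]
  unfold deltaS2
  have h := neg_pow_sq (A := A) a
  rw [show a + 1 + 1 = a + 2 by omega, pow_add]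
  linear_combination (-(∏ j ∈ Finset.Icc 2 (a + 2), x 1 j) * f (fun p q => x (p + 1) (q + 1))) * h

theorem cc_smul_right {A : Type*} [CommRing A] (a b : ℕ) (f g : (ℕ → ℕ → A) → A) (r : A)
    (x : ℕ → ℕ → A) : cc a b f (fun y => r * g y) x = r * cc a b f g x := by
  unfold cc
  rw [Finset.mul_sum]
  exact Finset.sum_congr rfl fun i _ => by ring

theorem cc_smul_left {A : Type*} [CommRing A] (a b : ℕ) (f g : (ℕ → ℕ → A) → A) (r : A)
    (x : ℕ → ℕ → A) : cc a b (fun y => r * f y) g x = r * cc a b f g x := by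
  unfold cc
  rw [Finset.mul_sum]
  exact Finset.sum_congr rfl fun i _ => by ring

theorem comp_mu {A : Type*} [CommRing A] {a b : ℕ} {f g : (ℕ → ℕ → A) → A}
    (hf : IsCochain (a + 1) f) (hg : IsCochain (b + 1) g)
    (hfc : cc a 1 f mu = fun x => (-1) ^ a * cc 1 a mu f x)
    (hgc : cc b 1 g mu = fun x => (-1) ^ b * cc 1 b mu g x) (x : ℕ → ℕ → A) :
    cc (a + b) 1 (cc a b f g) mu x = (-1) ^ (a + b) * cc (1 + a) b (cc 1 a mu f) g x := by
  have h := assoc_symm hf hg mu_cochain x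
  rw [hgc, hfc, cc_smul_right, cc_smul_left, mul_one, add_comm b 1, add_comm a 1] at h
  rw [pow_add]
  linear_combination h


/-- the Gerstenhaber bracket of two cocycles is a cocycle: if `δₙ(f) = 0` and
`δₘ(g) = 0` then `δ_{n+m-1}([f,g]) = 0`; hence the bracket descends to `H*_{S²}(A,A)`. -/
theorem deltaS2_brackS2_of_cocycles {A : Type*} [CommRing A]
    (n m : ℕ) (hn : 1 ≤ n) (hm : 1 ≤ m)
    (f g : (ℕ → ℕ → A) → A) (hf : IsCochain n f) (hg : IsCochain m g)
    (hfc : ∀ a : ℕ → ℕ → A, deltaS2 n f a = 0) (hgc : ∀ a : ℕ → ℕ → A, deltaS2 m g a = 0) :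
    ∀ a : ℕ → ℕ → A, deltaS2 (n + m - 1) (brackS2 n m f g) a = 0 := by
  intro x
  obtain ⟨a, rfl⟩ : ∃ a, n = a + 1 := ⟨n - 1, by omega⟩
  obtain ⟨b, rfl⟩ : ∃ b, m = b + 1 := ⟨m - 1, by omega⟩
  have hfc' : cc a 1 f mu = fun x => (-1) ^ a * cc 1 a mu f x := by
    funext y
    have := hfc y
    rw [delta_eq hf] at this
    linear_combination -this
  have hgc' : cc b 1 g mu = fun x => (-1) ^ b * cc 1 b mu g x := by
    funext y
    have := hgc y
    rw [delta_eq hg] at this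
    linear_combination -this
  have hB : brackS2 (a + 1) (b + 1) f g =
      fun y => cc a b f g y - (-1) ^ (a * b) * cc b a g f y := by
    funext y
    unfold brackS2
    rw [circS2_eq b hf, circS2_eq a hg]
    simp
  have c1 : IsCochain (a + b + 1) (cc a b f g) := cc_cochain hf hg
  have c2 : IsCochain (a + b + 1) (cc b a g f) := by
    rw [add_comm a b]; exact cc_cochain hg hf
  rw [show a + 1 + (b + 1) - 1 = a + b + 1 by omega, hB, delta_eq (a := a + b)]
  · have l1 : cc (a + b) 1 (fun y => cc a b f g y - (-1) ^ (a * b) * cc b a g f y) mu x =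
        cc (a + b) 1 (cc a b f g) mu x - (-1) ^ (a * b) * cc (a + b) 1 (cc b a g f) mu x := by
      conv_rhs => unfold cc
      conv_lhs => unfold cc
      rw [Finset.mul_sum, ← Finset.sum_sub_distrib]
      exact Finset.sum_congr rfl fun i _ => by ring
    have l2 : cc 1 (a + b) mu (fun y => cc a b f g y - (-1) ^ (a * b) * cc b a g f y) x =
        cc 1 (a + b) mu (cc a b f g) x - (-1) ^ (a * b) * cc 1 (a + b) mu (cc b a g f) x := by
      conv_rhs => unfold cc
      conv_lhs => unfold cc
      rw [Finset.mul_sum, ← Finset.sum_sub_distrib]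
      exact Finset.sum_congr rfl fun i _ => by ring
    have h1 := comp_mu hf hg hfc' hgc' x
    have h2 := comp_mu hg hf hgc' hfc' x
    have h3 := assoc_symm mu_cochain hf hg x
    rw [add_comm b a] at h2 h3
    rw [l1, l2, h1, h2]
    linear_combination (-(-1) ^ (a + b)) * h3
  · intro y z h
    simp only [c1 y z h, c2 y z h]
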